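/- Let V be a finite-dimensional ℂ-vector space which is a module over a finite-dimensional semisimple ℂ-algebra H. Suppose V_ε is a family of H-modules on the same vector space V depending continuously on a parameter ε ∈ [0,1] (i.e. the action maps H → End(V) vary continuously). Then for any fixed irreducible H-module S, the multiplicity of S in V_ε is constant in ε. -/

import Mathlib

/-- A simple module over a semisimple ring is, up to isomorphism, the left ideal generated by an
idempotent `e`; here `s` is the generator of the module corresponding to `e`. -/
lemma exists_idempotent_of_isSimpleModule {H S : Type*} [Ring H] [IsSemisimpleRing H]
    [AddCommGroup S] [Module H S] [IsSimpleModule H S] :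
    ∃ (s : S) (g : S →ₗ[H] H), IsIdempotentElem (g s) ∧ ∀ x, g x • s = x := by
  have := IsSimpleModule.nontrivial H S
  obtain ⟨t, ht⟩ := exists_ne (0 : S)
  obtain ⟨g, hg⟩ := IsSemisimpleModule.lifting_property (LinearMap.toSpanSingleton H S t)
    (IsSimpleModule.toSpanSingleton_surjective H ht) LinearMap.id
  have hgt (x : S) : g x • t = x := LinearMap.congr_fun hg x
  refine ⟨t, g, ?_, hgt⟩
  rw [IsIdempotentElem, ← smul_eq_mul, ← map_smul, hgt]

/-- If `S` is generated by `s` and `g : S → H` is a section of `h ↦ h • s`, then evaluation at `s`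
identifies `Hom_H(S, V)` with `e V`, where `e = g s` is idempotent, so its dimension is the trace
of `e` acting on `V`. -/
lemma finrank_linearMap_eq_trace {K H S V : Type*} [Field K] [Ring H]
    [AddCommGroup S] [Module H S] [AddCommGroup V] [Module K V] [FiniteDimensional K V]
    [Module H V] [SMulCommClass H K V] (s : S) (g : S →ₗ[H] H)
    (hidem : IsIdempotentElem (g s)) (hg : ∀ x, g x • s = x)
    (P : V →ₗ[K] V) (hP : ∀ v, P v = g s • v) :
    (Module.finrank K (S →ₗ[H] V) : K) = LinearMap.trace K V P := by
  have hPP : IsIdempotentElem P := by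
    ext v
    simp [hP, smul_smul, hidem.eq]
  rw [((LinearMap.isProj_range_iff_isIdempotentElem P).2 hPP).trace]
  congr 1
  let ev : (S →ₗ[H] V) →ₗ[K] V :=
    { toFun f := f s
      map_add' _ _ := rfl
      map_smul' _ _ := rfl }
  have hev : Function.Injective ev := fun f₁ f₂ h ↦ LinearMap.ext fun x ↦ by
    rw [← hg x, map_smul, map_smul]
    exact congrArg (g x • ·) h
  have hrange : LinearMap.range ev = LinearMap.range P := by
    apply le_antisymm
    · rintro _ ⟨f, rfl⟩
      refine ⟨f s, ?_⟩
      rw [hP, ← map_smul, hg]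
      rfl
    · rintro _ ⟨v, rfl⟩
      exact ⟨(LinearMap.toSpanSingleton H V v).comp g, (hP v).symm⟩
  rw [← hrange, LinearMap.finrank_range_of_inj hev]

/-- The trace of a pointwise continuous family of endomorphisms is continuous. -/
lemma ContinuousOn.linearMap_trace {X V : Type*} [TopologicalSpace X] [NormedAddCommGroup V]
    [NormedSpace ℂ V] [FiniteDimensional ℂ V] {f : X → V →ₗ[ℂ] V} {t : Set X}
    (hf : ∀ v, ContinuousOn (fun x ↦ f x v) t) :
    ContinuousOn (fun x ↦ LinearMap.trace ℂ V (f x)) t := by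
  let b := Module.finBasis ℂ V
  simp only [LinearMap.trace_eq_matrix_trace ℂ b, Matrix.trace, Matrix.diag_apply,
    LinearMap.toMatrix_apply]
  exact continuousOn_finsetSum _ fun i _ ↦
    (b.coord i).continuous_of_finiteDimensional.comp_continuousOn (hf (b i))

/-- A natural-number valued function that is continuous as a complex function on a preconnected
set is constant there. -/
lemma IsPreconnected.natCast_constant {X : Type*} [TopologicalSpace X] {t : Set X}
    (ht : IsPreconnected t) {n : X → ℕ} (hn : ContinuousOn (fun x ↦ (n x : ℂ)) t)
    {x y : X} (hx : x ∈ t) (hy : y ∈ t) : n x = n y := by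
  refine ht.constant (Nat.isClosedEmbedding_coe_real.isInducing.continuousOn_iff.2 ?_) hx hy
  simpa [Function.comp_def] using Complex.continuous_re.comp_continuousOn hn

/-- For a continuous family `ρ ε` (ε ∈ [0,1]) of module structures over a fixed
finite-dimensional semisimple ℂ-algebra `H` on a fixed finite-dimensional space `V`,
the multiplicity `dim Hom_H(S, V_ε)` of a fixed irreducible `H`-module `S` is constant. -/
theorem stmt4 {H : Type*} [Ring H] [Algebra ℂ H] [IsSemisimpleRing H]
    [FiniteDimensional ℂ H]
    {V : Type*} [NormedAddCommGroup V] [NormedSpace ℂ V] [FiniteDimensional ℂ V]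
    (ρ : ℝ → (H →ₐ[ℂ] Module.End ℂ V))
    (hcont : ∀ (h : H) (v : V), ContinuousOn (fun ε : ℝ => ρ ε h v) (Set.Icc 0 1))
    {S : Type*} [AddCommGroup S] [Module ℂ S] [Module H S] [IsScalarTower ℂ H S]
    [IsSimpleModule H S] [FiniteDimensional ℂ S]
    (ε ε' : ℝ) (hε : ε ∈ Set.Icc (0 : ℝ) 1) (hε' : ε' ∈ Set.Icc (0 : ℝ) 1) :
    (letI : Module H V := Module.compHom V (ρ ε).toRingHom
     haveI : SMulCommClass H ℂ V := ⟨fun h c v => map_smul (ρ ε h) c v⟩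
     Module.finrank ℂ (S →ₗ[H] V)) =
    (letI : Module H V := Module.compHom V (ρ ε').toRingHom
     haveI : SMulCommClass H ℂ V := ⟨fun h c v => map_smul (ρ ε' h) c v⟩
     Module.finrank ℂ (S →ₗ[H] V)) := by
  obtain ⟨s, g, hidem, hg⟩ := exists_idempotent_of_isSimpleModule (H := H) (S := S)
  refine isPreconnected_Icc.natCast_constant (n := fun δ ↦
    letI : Module H V := Module.compHom V (ρ δ).toRingHom
    haveI : SMulCommClass H ℂ V := ⟨fun h c v => map_smul (ρ δ h) c v⟩
    Module.finrank ℂ (S →ₗ[H] V)) ?_ hε hε'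
  refine (ContinuousOn.linearMap_trace (hcont (g s))).congr fun δ _ ↦ ?_
  let _ : Module H V := Module.compHom V (ρ δ).toRingHom
  have : SMulCommClass H ℂ V := ⟨fun h c v => map_smul (ρ δ h) c v⟩
  exact finrank_linearMap_eq_trace s g hidem hg (ρ δ (g s)) fun _ ↦ rfl
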